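/- arXiv:2102.00388 — 5 statements merged into one kernel-verified Lean document; each statement's English description precedes it below -/
import Mathlib

section
/- Let q be a real number with 0 < q < 1. Then ∑_{k ∈ ℤ} q^{k²/2 + k} = (-q^{3/2};q)_∞ · (-q^{-1/2};q)_∞ · (q;q)_∞. (This is the instance x = -q^{3/2} of the Jacobi triple product identity ∑_{n ∈ ℤ} (-1)^n q^{n(n-1)/2} x^n = (x;q)_∞ (q/x;q)_∞ (q;q)_∞, and it evaluates the total mass of the discrete Stieltjes–Wigert measure.) -/
open scoped BigOperators

/-- The infinite q-Pochhammer symbol `(a;q)_∞ = ∏_{k=0}^{∞} (1 - a q^k)`. -/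
noncomputable def qPochInf (a q : ℝ) : ℝ := ∏' k : ℕ, (1 - a * q ^ k)

open Filter Topology

/-- The Gaussian binomial coefficient, defined through the `q`-Pascal recursion. -/
noncomputable def gaussBinom (q : ℝ) : ℕ → ℕ → ℝ
  | _, 0 => 1
  | 0, _ + 1 => 0
  | n + 1, k + 1 => gaussBinom q n k + q ^ (k + 1) * gaussBinom q n (k + 1)

/-- The finite `q`-Pochhammer symbol `(q;q)_n`. -/
noncomputable def qPochSelf (q : ℝ) (n : ℕ) : ℝ := ∏ i ∈ Finset.range n, (1 - q * q ^ i)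

theorem gaussBinom_zero_right (q : ℝ) (n : ℕ) : gaussBinom q n 0 = 1 := by
  cases n <;> rfl

theorem gaussBinom_succ_succ (q : ℝ) (n k : ℕ) :
    gaussBinom q (n + 1) (k + 1) = gaussBinom q n k + q ^ (k + 1) * gaussBinom q n (k + 1) := rfl

theorem gaussBinom_eq_zero_of_lt (q : ℝ) {n k : ℕ} (h : n < k) : gaussBinom q n k = 0 := by
  induction n generalizing k with
  | zero =>
    obtain ⟨k, rfl⟩ := Nat.exists_eq_succ_of_ne_zero h.ne'
    rfl
  | succ n ih =>
    obtain ⟨k, rfl⟩ := Nat.exists_eq_succ_of_ne_zero (Nat.ne_zero_of_lt h)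
    rw [Nat.succ_eq_add_one, gaussBinom_succ_succ, ih (by omega), ih (by omega)]
    simp

theorem qPochSelf_succ (q : ℝ) (n : ℕ) : qPochSelf q (n + 1) = qPochSelf q n * (1 - q ^ (n + 1)) := by
  rw [qPochSelf, Finset.prod_range_succ, ← qPochSelf, pow_succ']

theorem gaussBinom_mul_qPochSelf (q : ℝ) {n j m : ℕ} (h : j + m = n) :
    gaussBinom q n j * (qPochSelf q j * qPochSelf q m) = qPochSelf q n := by
  induction n generalizing j m with
  | zero =>
    obtain ⟨rfl, rfl⟩ : j = 0 ∧ m = 0 := by omega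
    simp [gaussBinom_zero_right, qPochSelf]
  | succ n ih =>
    rcases j with _ | j
    · obtain rfl : m = n + 1 := by omega
      simp [gaussBinom_zero_right, qPochSelf]
    rcases m with _ | m
    · obtain rfl : j = n := by omega
      have := ih (j := j) (m := 0) (by omega)
      rw [gaussBinom_succ_succ, gaussBinom_eq_zero_of_lt q (Nat.lt_succ_self j), qPochSelf_succ]
      linear_combination (1 - q ^ (j + 1)) * this
    · have h₁ := ih (j := j) (m := m + 1) (by omega)
      have h₂ := ih (j := j + 1) (m := m) (by omega)
      obtain rfl : n = j + m + 1 := by omega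
      rw [gaussBinom_succ_succ, qPochSelf_succ q (j + m + 1)]
      rw [qPochSelf_succ] at h₁ h₂ ⊢
      rw [qPochSelf_succ q m]
      linear_combination (1 - q ^ (j + 1)) * h₁ + q ^ (j + 1) * (1 - q ^ (m + 1)) * h₂

/-- The finite `q`-binomial theorem. -/
theorem prod_one_add_mul_sq_pow (s y : ℝ) (n : ℕ) :
    ∏ i ∈ Finset.range n, (1 + y * (s ^ 2) ^ i) =
      ∑ j ∈ Finset.range (n + 1), gaussBinom (s ^ 2) n j * (s ^ (j * (j - 1)) * y ^ j) := by
  induction n generalizing y with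
  | zero => simp [gaussBinom_zero_right]
  | succ n ih =>
    have hprod : ∏ i ∈ Finset.range n, (1 + y * (s ^ 2) ^ (i + 1)) =
        ∑ j ∈ Finset.range (n + 1), gaussBinom (s ^ 2) n j * (s ^ (j * (j + 1)) * y ^ j) := by
      rw [← Finset.prod_congr rfl (fun i _ => by rw [pow_succ' (s ^ 2) i, ← mul_assoc]), ih]
      refine Finset.sum_congr rfl fun j _ => ?_
      rcases j with _ | j
      · simp
      · simp only [Nat.add_sub_cancel]
        ring
    have hshift : ∑ j ∈ Finset.range (n + 1), gaussBinom (s ^ 2) n j * (s ^ (j * (j + 1)) * y ^ j) =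
        1 + ∑ j ∈ Finset.range (n + 1),
          gaussBinom (s ^ 2) n (j + 1) * (s ^ ((j + 1) * (j + 1 + 1)) * y ^ (j + 1)) := by
      rw [Finset.sum_range_succ' _ n, Finset.sum_range_succ _ n,
        gaussBinom_eq_zero_of_lt _ (Nat.lt_succ_self n), gaussBinom_zero_right]
      simp [add_comm (1 : ℝ)]
    rw [Finset.prod_range_succ', hprod, Finset.sum_range_succ' _ (n + 1), pow_zero, mul_one, mul_add,
      mul_one]
    nth_rewrite 1 [hshift]
    rw [Finset.sum_mul, gaussBinom_zero_right, add_assoc, ← Finset.sum_add_distrib]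
    simp only [zero_mul, pow_zero, mul_one]
    rw [add_comm]
    congr 1
    refine Finset.sum_congr rfl fun j _ => ?_
    rw [gaussBinom_succ_succ, Nat.add_sub_cancel]
    ring

theorem mul_prod_one_add_zpow {s w : ℝ} (hs : s ≠ 0) (hw : w ≠ 0) (n : ℕ) :
    s ^ (n ^ 2) * (w ^ n)⁻¹ * ∏ i ∈ Finset.range n, (1 + w * s ^ (1 - 2 * n : ℤ) * (s ^ 2) ^ i) =
      ∏ i ∈ Finset.range n, (1 + s / w * (s ^ 2) ^ i) := by
  induction n with
  | zero => simp
  | succ n ih =>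
    have hs' : s ^ (1 - 2 * ((n + 1 : ℕ) : ℤ)) * s ^ 2 = s ^ (1 - 2 * n : ℤ) := by
      rw [← zpow_natCast s 2, ← zpow_add₀ hs]
      congr 1
      push_cast
      ring
    have hs'' : s ^ (1 - 2 * ((n + 1 : ℕ) : ℤ)) = (s ^ (2 * n + 1))⁻¹ := by
      rw [← zpow_natCast, ← zpow_neg]
      congr 1
    rw [Finset.prod_range_succ', Finset.prod_range_succ, ← ih]
    have hcongr : ∏ i ∈ Finset.range n,
        (1 + w * s ^ (1 - 2 * ((n + 1 : ℕ) : ℤ)) * (s ^ 2) ^ (i + 1)) =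
        ∏ i ∈ Finset.range n, (1 + w * s ^ (1 - 2 * n : ℤ) * (s ^ 2) ^ i) :=
      Finset.prod_congr rfl fun i _ => by rw [← hs']; ring
    rw [hcongr, hs'']
    generalize ∏ i ∈ Finset.range n, (1 + w * s ^ (1 - 2 * n : ℤ) * (s ^ 2) ^ i) = p
    field_simp
    ring

/-- The finite form of the Jacobi triple product identity. -/
theorem sum_gaussBinom_mul_zpow {s w : ℝ} (hs : s ≠ 0) (hw : w ≠ 0) (n : ℕ) :
    ∑ j ∈ Finset.range (2 * n + 1),
        gaussBinom (s ^ 2) (2 * n) j * (s ^ ((j - n : ℤ) ^ 2) * w ^ (j - n : ℤ)) =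
      (∏ i ∈ Finset.range n, (1 + s * w * (s ^ 2) ^ i)) *
        ∏ i ∈ Finset.range n, (1 + s / w * (s ^ 2) ^ i) := by
  have hterm (j : ℕ) : s ^ ((j - n : ℤ) ^ 2) * w ^ (j - n : ℤ) =
      s ^ (n ^ 2) * (w ^ n)⁻¹ * (s ^ (j * (j - 1)) * (w * s ^ (1 - 2 * n : ℤ)) ^ j) := by
    have hj : ((j * (j - 1) : ℕ) : ℤ) = j * (j - 1) := by
      rcases j with _ | j <;> simp
    have hexp : s ^ ((j - n : ℤ) ^ 2) =
        s ^ (n ^ 2) * s ^ (j * (j - 1)) * (s ^ (1 - 2 * n : ℤ)) ^ j := by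
      rw [← zpow_natCast s, ← zpow_natCast s, ← zpow_natCast (s ^ _), ← zpow_mul,
        ← zpow_add₀ hs, ← zpow_add₀ hs, hj]
      congr 1
      push_cast
      ring
    rw [hexp, zpow_sub₀ hw, zpow_natCast, zpow_natCast, mul_pow]
    ring
  have hprod : ∏ i ∈ Finset.range n, (1 + w * s ^ (1 - 2 * n : ℤ) * (s ^ 2) ^ (n + i)) =
      ∏ i ∈ Finset.range n, (1 + s * w * (s ^ 2) ^ i) := by
    refine Finset.prod_congr rfl fun i _ => ?_
    have hs' : s ^ (1 - 2 * n : ℤ) * (s ^ 2) ^ n = s := by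
      rw [← pow_mul, ← zpow_natCast s (2 * n), ← zpow_add₀ hs]
      simp
    rw [pow_add]
    linear_combination w * (s ^ 2) ^ i * hs'
  rw [← mul_prod_one_add_zpow hs hw, ← hprod, mul_left_comm, mul_comm (Finset.prod _ _),
    ← Finset.prod_range_add (fun i => 1 + w * s ^ (1 - 2 * n : ℤ) * (s ^ 2) ^ i), ← two_mul,
    prod_one_add_mul_sq_pow, Finset.mul_sum]
  refine Finset.sum_congr rfl fun j _ => ?_
  rw [hterm]
  ring

theorem tendsto_prod_qPochInf (a : ℝ) {q : ℝ} (hq0 : 0 ≤ q) (hq1 : q < 1) :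
    Tendsto (fun n => ∏ i ∈ Finset.range n, (1 - a * q ^ i)) atTop (𝓝 (qPochInf a q)) := by
  have hsum : Summable fun i : ℕ => -(a * q ^ i) :=
    ((summable_geometric_of_lt_one hq0 hq1).mul_left a).neg
  simpa only [qPochInf, sub_eq_add_neg] using
    (Real.multipliable_one_add_of_summable hsum).tendsto_prod_tprod_nat

theorem one_sub_mul_pow_pos {q : ℝ} (hq0 : 0 ≤ q) (hq1 : q < 1) (i : ℕ) : 0 < 1 - q * q ^ i := by
  rw [← pow_succ']
  exact sub_pos.2 (pow_lt_one₀ hq0 hq1 i.succ_ne_zero)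

theorem qPochSelf_pos {q : ℝ} (hq0 : 0 ≤ q) (hq1 : q < 1) (n : ℕ) : 0 < qPochSelf q n :=
  Finset.prod_pos fun i _ => one_sub_mul_pow_pos hq0 hq1 i

theorem qPochSelf_antitone {q : ℝ} (hq0 : 0 ≤ q) (hq1 : q < 1) : Antitone (qPochSelf q) :=
  antitone_nat_of_succ_le fun n => by
    rw [qPochSelf_succ]
    exact mul_le_of_le_one_right (qPochSelf_pos hq0 hq1 n).le (by linarith [pow_nonneg hq0 (n + 1)])

theorem qPochInf_self_le {q : ℝ} (hq0 : 0 ≤ q) (hq1 : q < 1) (n : ℕ) :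
    qPochInf q q ≤ qPochSelf q n :=
  (qPochSelf_antitone hq0 hq1).le_of_tendsto (tendsto_prod_qPochInf q hq0 hq1) n

theorem qPochInf_self_pos {q : ℝ} (hq0 : 0 ≤ q) (hq1 : q < 1) : 0 < qPochInf q q := by
  refine lt_of_le_of_ne (ge_of_tendsto' (tendsto_prod_qPochInf q hq0 hq1)
    fun n => (qPochSelf_pos hq0 hq1 n).le) (Ne.symm ?_)
  have hsum : Summable fun i : ℕ => ‖-(q * q ^ i)‖ :=
    ((summable_geometric_of_lt_one hq0 hq1).mul_left q).neg.norm
  simpa only [qPochInf, sub_eq_add_neg] using tprod_one_add_ne_zero_of_summable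
    (fun i => by simpa only [sub_eq_add_neg] using (one_sub_mul_pow_pos hq0 hq1 i).ne') hsum

theorem gaussBinom_eq_div {q : ℝ} (hq0 : 0 ≤ q) (hq1 : q < 1) {n j m : ℕ} (h : j + m = n) :
    gaussBinom q n j = qPochSelf q n / (qPochSelf q j * qPochSelf q m) := by
  rw [eq_div_iff (mul_pos (qPochSelf_pos hq0 hq1 j) (qPochSelf_pos hq0 hq1 m)).ne',
    gaussBinom_mul_qPochSelf q h]

theorem abs_gaussBinom_le {q : ℝ} (hq0 : 0 ≤ q) (hq1 : q < 1) (n j : ℕ) :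
    |gaussBinom q n j| ≤ (qPochInf q q * qPochInf q q)⁻¹ := by
  have hpos := qPochInf_self_pos hq0 hq1
  rcases lt_or_ge n j with h | h
  · rw [gaussBinom_eq_zero_of_lt q h, abs_zero]
    positivity
  · have hn := qPochSelf_pos hq0 hq1 n
    have hj := qPochSelf_pos hq0 hq1 j
    have hm := qPochSelf_pos hq0 hq1 (n - j)
    rw [gaussBinom_eq_div hq0 hq1 (Nat.add_sub_cancel' h), abs_of_pos (by positivity), ← one_div]
    refine div_le_div₀ zero_le_one ?_ (by positivity) (mul_le_mul (qPochInf_self_le hq0 hq1 j)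
      (qPochInf_self_le hq0 hq1 _) hpos.le hj.le)
    simpa [qPochSelf] using qPochSelf_antitone hq0 hq1 (Nat.zero_le n)

theorem tendsto_gaussBinom_central {q : ℝ} (hq0 : 0 ≤ q) (hq1 : q < 1) (k : ℤ) :
    Tendsto (fun n : ℕ => gaussBinom q (2 * n) (k + n).toNat) atTop (𝓝 (qPochInf q q)⁻¹) := by
  have hpos := qPochInf_self_pos hq0 hq1
  have hlim : Tendsto (qPochSelf q) atTop (𝓝 (qPochInf q q)) := tendsto_prod_qPochInf q hq0 hq1
  have htop (l : ℤ) : Tendsto (fun n : ℕ => (l + n).toNat) atTop atTop :=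
    tendsto_atTop.2 fun b => (eventually_ge_atTop (b + l.natAbs)).mono fun n hn => by omega
  have h2 : Tendsto (fun n : ℕ => 2 * n) atTop atTop :=
    tendsto_atTop.2 fun b => (eventually_ge_atTop b).mono fun n hn => by omega
  have key := (hlim.comp h2).div ((hlim.comp (htop k)).mul (hlim.comp (htop (-k))))
    (mul_pos hpos hpos).ne'
  rw [div_mul_cancel_left₀ hpos.ne'] at key
  refine key.congr' ((eventually_ge_atTop k.natAbs).mono fun n hn => ?_)
  have hadd : (k + n).toNat + (-k + n).toNat = 2 * n := by omega
  exact (gaussBinom_eq_div hq0 hq1 hadd).symm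

theorem summable_zpow_sq_mul_zpow {s w : ℝ} (hs0 : 0 < s) (hs1 : s < 1) (hw : w ≠ 0) :
    Summable fun k : ℤ => s ^ (k ^ 2) * w ^ k := by
  have hnat {v : ℝ} (hv : v ≠ 0) : Summable fun n : ℕ => s ^ (n ^ 2) * v ^ n := by
    refine summable_of_ratio_test_tendsto_lt_one zero_lt_one
      (Eventually.of_forall fun n => mul_ne_zero (pow_ne_zero _ hs0.ne') (pow_ne_zero _ hv)) ?_
    have hlim : Tendsto (fun n : ℕ => s * |v| * (s ^ 2) ^ n) atTop (𝓝 0) := by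
      simpa using (tendsto_pow_atTop_nhds_zero_of_lt_one (sq_nonneg s)
        (pow_lt_one₀ hs0.le hs1 two_ne_zero)).const_mul (s * |v|)
    refine hlim.congr fun n => ?_
    have hv' : |v| ≠ 0 := abs_ne_zero.2 hv
    rw [norm_mul, norm_mul, norm_pow, norm_pow, norm_pow, norm_pow, Real.norm_eq_abs,
      Real.norm_eq_abs, abs_of_pos hs0]
    field_simp
    ring
  refine Summable.of_nat_of_neg ?_ ?_
  · exact_mod_cast hnat hw
  · refine (hnat (inv_ne_zero hw)).congr fun n => ?_
    rw [neg_sq, zpow_neg, zpow_natCast, inv_pow]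
    norm_cast

/-- The Jacobi triple product identity for a nonzero real argument. -/
theorem hasSum_jacobi_triple_product {s w : ℝ} (hs0 : 0 < s) (hs1 : s < 1) (hw : w ≠ 0) :
    HasSum (fun k : ℤ => s ^ (k ^ 2) * w ^ k)
      (qPochInf (-(s * w)) (s ^ 2) * qPochInf (-(s / w)) (s ^ 2) * qPochInf (s ^ 2) (s ^ 2)) := by
  have hq0 : 0 ≤ s ^ 2 := sq_nonneg s
  have hq1 : s ^ 2 < 1 := pow_lt_one₀ hs0.le hs1 two_ne_zero
  have hpos := qPochInf_self_pos hq0 hq1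
  have hsum := summable_zpow_sq_mul_zpow hs0 hs1 hw
  set c : ℕ → ℤ → ℝ := fun n k =>
    if -(n : ℤ) ≤ k then gaussBinom (s ^ 2) (2 * n) (k + n).toNat else 0 with hc
  have hfinite (n : ℕ) : ∑' k : ℤ, c n k * (s ^ (k ^ 2) * w ^ k) =
      (∏ i ∈ Finset.range n, (1 + s * w * (s ^ 2) ^ i)) *
        ∏ i ∈ Finset.range n, (1 + s / w * (s ^ 2) ^ i) := by
    rw [← sum_gaussBinom_mul_zpow hs0.ne' hw,
      tsum_eq_sum (s := (Finset.range (2 * n + 1)).image fun j : ℕ => (j - n : ℤ)),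
      Finset.sum_image fun a _ b _ h => by simpa using h]
    · refine Finset.sum_congr rfl fun j _ => ?_
      simp [hc]
    · intro k hk
      by_cases hkn : -(n : ℤ) ≤ k
      · have hlt : 2 * n < (k + n).toNat := by
          by_contra! hle
          exact hk (Finset.mem_image.2 ⟨(k + n).toNat, Finset.mem_range.2 (by omega), by omega⟩)
        simp [hc, gaussBinom_eq_zero_of_lt _ hlt]
      · simp [hc, hkn]
  have hleft : Tendsto (fun n => ∑' k : ℤ, c n k * (s ^ (k ^ 2) * w ^ k)) atTop
      (𝓝 (∑' k : ℤ, (qPochInf (s ^ 2) (s ^ 2))⁻¹ * (s ^ (k ^ 2) * w ^ k))) := by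
    refine tendsto_tsum_of_dominated_convergence
      (hsum.norm.mul_left (qPochInf (s ^ 2) (s ^ 2) * qPochInf (s ^ 2) (s ^ 2))⁻¹)
      (fun k => Tendsto.mul_const _ ?_) (Eventually.of_forall fun n k => ?_)
    · refine (tendsto_gaussBinom_central hq0 hq1 k).congr'
        ((eventually_ge_atTop k.natAbs).mono fun n hn => ?_)
      simp only [hc]
      rw [if_pos (by omega)]
    · rw [norm_mul]
      refine mul_le_mul_of_nonneg_right ?_ (norm_nonneg _)
      simp only [hc]
      split_ifs
      · exact abs_gaussBinom_le hq0 hq1 _ _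
      · rw [norm_zero]
        positivity
  have hright : Tendsto (fun n => ∑' k : ℤ, c n k * (s ^ (k ^ 2) * w ^ k)) atTop
      (𝓝 (qPochInf (-(s * w)) (s ^ 2) * qPochInf (-(s / w)) (s ^ 2))) := by
    simp only [hfinite]
    simpa only [neg_mul, sub_neg_eq_add] using
      (tendsto_prod_qPochInf (-(s * w)) hq0 hq1).mul (tendsto_prod_qPochInf (-(s / w)) hq0 hq1)
  have heq := tendsto_nhds_unique hleft hright
  rw [tsum_mul_left, inv_mul_eq_iff_eq_mul₀ hpos.ne', mul_comm] at heq
  exact heq ▸ hsum.hasSum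

/-- Jacobi triple product instance `x = -q^{3/2}`:
`∑_{k ∈ ℤ} q^{k²/2 + k} = (-q^{3/2};q)_∞ (-q^{-1/2};q)_∞ (q;q)_∞`. -/
theorem stieltjesWigert_total_mass (q : ℝ) (hq0 : 0 < q) (hq1 : q < 1) :
    HasSum (fun k : ℤ => q ^ (((k : ℝ) ^ 2) / 2 + (k : ℝ)))
      (qPochInf (-(q ^ ((3 : ℝ) / 2))) q * qPochInf (-(q ^ (-(1 : ℝ) / 2))) q * qPochInf q q) := by
  have hs0 : 0 < q ^ ((1 : ℝ) / 2) := Real.rpow_pos_of_pos hq0 _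
  have hs1 : q ^ ((1 : ℝ) / 2) < 1 := Real.rpow_lt_one hq0.le hq1 (by norm_num)
  have hsq : (q ^ ((1 : ℝ) / 2)) ^ 2 = q := by
    rw [← Real.rpow_natCast, ← Real.rpow_mul hq0.le]
    norm_num
  have hmul : q ^ ((1 : ℝ) / 2) * q = q ^ ((3 : ℝ) / 2) := by
    rw [← Real.rpow_add_one hq0.ne']
    norm_num
  have hdiv : q ^ ((1 : ℝ) / 2) / q = q ^ (-(1 : ℝ) / 2) := by
    rw [← Real.rpow_sub_one hq0.ne']
    norm_num
  have h := hasSum_jacobi_triple_product hs0 hs1 hq0.ne'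
  rw [hsq, hmul, hdiv] at h
  convert h using 2 with k
  rw [Real.rpow_add hq0, Real.rpow_intCast, ← Real.rpow_intCast (q ^ _), ← Real.rpow_mul hq0.le]
  congr 2
  push_cast
  ring
end

section
/- Let k be a positive real number. For every natural number n, ∫_0^∞ x^n · (k/√π) · exp(-k² (log x)²) dx = exp((n+1)²/(4k²)). That is, the n-th moment of the continuous Stieltjes–Wigert weight w(x) = (k/√π) x^{-k² log x} on (0,∞) equals e^{(n+1)²/4k²}; equivalently, setting q = e^{-1/(2k²)}, the n-th moment equals q^{-(n+1)²/2}. -/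
/-- Change of variables `x = exp t` on the half-line `(0, ∞)`. -/
theorem integral_Ioi_zero_eq_integral_exp_mul_comp_exp (g : ℝ → ℝ) :
    ∫ x in Set.Ioi (0 : ℝ), g x = ∫ t : ℝ, Real.exp t * g (Real.exp t) := by
  have h := MeasureTheory.integral_image_eq_integral_abs_deriv_smul MeasurableSet.univ
    (fun t _ => (Real.hasDerivAt_exp t).hasDerivWithinAt) Real.exp_injective.injOn g
  simpa [Set.image_univ, Real.range_exp, abs_of_pos (Real.exp_pos _)] using h

/-- The `n`-th moment of the continuous Stieltjes–Wigert weight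
`w(x) = (k/√π) exp(-k²(log x)²)` on `(0,∞)` equals `e^{(n+1)²/(4k²)}`. -/
theorem stieltjesWigert_continuous_moment (k : ℝ) (hk : 0 < k) (n : ℕ) :
    ∫ x in Set.Ioi (0 : ℝ),
        x ^ n * ((k / Real.sqrt Real.pi) * Real.exp (-(k ^ 2) * (Real.log x) ^ 2)) =
      Real.exp (((n : ℝ) + 1) ^ 2 / (4 * k ^ 2)) := by
  rw [integral_Ioi_zero_eq_integral_exp_mul_comp_exp]
  have complete_square (t : ℝ) :
      Real.exp t * (Real.exp t ^ n *
        ((k / Real.sqrt Real.pi) * Real.exp (-(k ^ 2) * (Real.log (Real.exp t)) ^ 2))) =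
      (k / Real.sqrt Real.pi * Real.exp (((n : ℝ) + 1) ^ 2 / (4 * k ^ 2))) *
        Real.exp (-(k ^ 2) * (t - ((n : ℝ) + 1) / (2 * k ^ 2)) ^ 2) := by
    have hexp : Real.exp t * Real.exp t ^ n * Real.exp (-(k ^ 2) * t ^ 2) =
        Real.exp (((n : ℝ) + 1) ^ 2 / (4 * k ^ 2)) *
          Real.exp (-(k ^ 2) * (t - ((n : ℝ) + 1) / (2 * k ^ 2)) ^ 2) := by
      rw [← Real.exp_nat_mul, ← Real.exp_add, ← Real.exp_add, ← Real.exp_add]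
      congr 1
      field_simp
      ring
    rw [Real.log_exp]
    linear_combination (k / Real.sqrt Real.pi) * hexp
  simp_rw [complete_square]
  rw [MeasureTheory.integral_const_mul,
    MeasureTheory.integral_sub_right_eq_self (fun t : ℝ => Real.exp (-(k ^ 2) * t ^ 2)),
    integral_gaussian, Real.sqrt_div Real.pi_pos.le, Real.sqrt_sq hk.le]
  have hpi : Real.sqrt Real.pi ≠ 0 := (Real.sqrt_pos.mpr Real.pi_pos).ne'
  field_simp
end

section
/- Let q be a real number with 0 < q < 1. For every natural number n, the Jackson q-integral ∫_{-1}^1 x^n (qx;q)_∞ (-qx;q)_∞ d_q x equals 0 when n is odd, and equals (1-q) (q;q)_∞ (-1;q)_∞ (-q;q)_∞ · (q;q²)_m when n = 2m is even. (These are the moments of the discrete q-Hermite I weight.) -/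
open scoped BigOperators

/-- The finite q-Pochhammer symbol `(a;q)_n = ∏_{k=0}^{n-1} (1 - a q^k)`. -/
noncomputable def qPoch (a q : ℝ) (n : ℕ) : ℝ := ∏ k ∈ Finset.range n, (1 - a * q ^ k)

open scoped Topology
open Filter

lemma summable_norm_neg_mul_pow (a : ℝ) {q : ℝ} (hq0 : 0 < q) (hq1 : q < 1) :
    Summable fun k : ℕ => ‖-(a * q ^ k)‖ :=
  ((summable_geometric_of_lt_one hq0.le hq1).mul_left a).neg.norm

lemma multipliable_one_sub_mul_pow (a : ℝ) {q : ℝ} (hq0 : 0 < q) (hq1 : q < 1) :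
    Multipliable fun k : ℕ => 1 - a * q ^ k := by
  simpa only [sub_eq_add_neg] using
    multipliable_one_add_of_summable (summable_norm_neg_mul_pow a hq0 hq1)

lemma tendsto_qPoch (a : ℝ) {q : ℝ} (hq0 : 0 < q) (hq1 : q < 1) :
    Tendsto (qPoch a q) atTop (𝓝 (qPochInf a q)) :=
  (multipliable_one_sub_mul_pow a hq0 hq1).hasProd.tendsto_prod_nat

lemma qPochInf_eq_mul (a : ℝ) {q : ℝ} (hq0 : 0 < q) (hq1 : q < 1) :
    qPochInf a q = (1 - a) * qPochInf (a * q) q := by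
  have h : ∀ k : ℕ, 1 - a * q ^ (k + 1) = 1 - a * q * q ^ k := fun k => by ring
  unfold qPochInf
  rw [tprod_eq_zero_mul']
  · simp [h]
  · simpa only [h] using multipliable_one_sub_mul_pow (a * q) hq0 hq1

lemma qPochInf_mul_qPochInf_neg (a : ℝ) {q : ℝ} (hq0 : 0 < q) (hq1 : q < 1) :
    qPochInf a q * qPochInf (-a) q = qPochInf (a ^ 2) (q ^ 2) := by
  unfold qPochInf
  rw [← (multipliable_one_sub_mul_pow a hq0 hq1).tprod_mul
    (multipliable_one_sub_mul_pow (-a) hq0 hq1)]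
  exact tprod_congr fun k => by ring

lemma qPochInf_even_mul_odd (a : ℝ) {q : ℝ} (hq0 : 0 < q) (hq1 : q < 1) :
    qPochInf a (q ^ 2) * qPochInf (a * q) (q ^ 2) = qPochInf a q := by
  have h0 : 0 < q ^ 2 := by positivity
  have h1 : q ^ 2 < 1 := by nlinarith
  have he : (fun k : ℕ => 1 - a * (q ^ 2) ^ k) = fun k => 1 - a * q ^ (2 * k) := by
    funext k; ring
  have ho : (fun k : ℕ => 1 - a * q * (q ^ 2) ^ k) = fun k => 1 - a * q ^ (2 * k + 1) := by
    funext k; ring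
  have me := multipliable_one_sub_mul_pow a h0 h1
  have mo := multipliable_one_sub_mul_pow (a * q) h0 h1
  rw [he] at me
  rw [ho] at mo
  rw [qPochInf, qPochInf, qPochInf, he, ho]
  exact tprod_even_mul_odd (f := fun k : ℕ => 1 - a * q ^ k) me mo

lemma qPochInf_self_ne_zero {q : ℝ} (hq0 : 0 < q) (hq1 : q < 1) : qPochInf q q ≠ 0 := by
  have h := tprod_one_add_ne_zero_of_summable (f := fun k : ℕ => -(q * q ^ k))
    (fun k => by
      have : q * q ^ k < 1 := by
        rw [← pow_succ']
        exact pow_lt_one₀ hq0.le hq1 (Nat.succ_ne_zero k)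
      linarith) (summable_norm_neg_mul_pow q hq0 hq1)
  simpa only [qPochInf, sub_eq_add_neg] using h

/-- Euler's identity `(q;q²)_∞ (-q;q)_∞ = 1`. -/
lemma qPochInf_sq_mul_qPochInf_neg {q : ℝ} (hq0 : 0 < q) (hq1 : q < 1) :
    qPochInf q (q ^ 2) * qPochInf (-q) q = 1 := by
  have h0 : 0 < q ^ 2 := by positivity
  have h1 : q ^ 2 < 1 := by nlinarith
  have h2 := qPochInf_even_mul_odd q hq0 hq1
  have h3 := qPochInf_mul_qPochInf_neg q hq0 hq1
  rw [← sq] at h2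
  apply mul_right_cancel₀ (qPochInf_self_ne_zero h0 h1)
  linear_combination qPochInf (-q) q * h2 + h3

lemma abs_qPochInf_le_one {a q : ℝ} (ha0 : 0 ≤ a) (ha1 : a ≤ 1) (hq0 : 0 < q) (hq1 : q < 1) :
    |qPochInf a q| ≤ 1 := by
  have h : ∀ k : ℕ, 0 ≤ 1 - a * q ^ k ∧ 1 - a * q ^ k ≤ 1 := fun k =>
    ⟨sub_nonneg.2 (mul_le_one₀ ha1 (by positivity) (pow_le_one₀ hq0.le hq1.le)),
      sub_le_self _ (by positivity)⟩
  refine le_of_tendsto (tendsto_qPoch a hq0 hq1).abs (Eventually.of_forall fun n => ?_)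
  rw [qPoch, abs_of_nonneg (Finset.prod_nonneg fun k _ => (h k).1)]
  exact Finset.prod_le_one (fun k _ => (h k).1) fun k _ => (h k).2

/-- The series `∑ z^s (p^{s+1};p)_∞`, equal to `(p;p)_∞ / (z;p)_∞`. -/
noncomputable def eulerSeries (p z : ℝ) : ℝ := ∑' s : ℕ, z ^ s * qPochInf (p ^ (s + 1)) p

lemma norm_pow_mul_qPochInf_le {p z : ℝ} (hp0 : 0 < p) (hp1 : p < 1) (hz0 : 0 ≤ z) (s : ℕ) :
    ‖z ^ s * qPochInf (p ^ (s + 1)) p‖ ≤ z ^ s := by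
  rw [norm_mul, norm_pow, Real.norm_eq_abs, Real.norm_eq_abs, abs_of_nonneg hz0]
  exact mul_le_of_le_one_right (by positivity)
    (abs_qPochInf_le_one (by positivity) (pow_le_one₀ hp0.le hp1.le) hp0 hp1)

lemma summable_eulerSeries {p z : ℝ} (hp0 : 0 < p) (hp1 : p < 1) (hz0 : 0 ≤ z) (hz1 : z < 1) :
    Summable fun s : ℕ => z ^ s * qPochInf (p ^ (s + 1)) p :=
  Summable.of_norm_bounded (summable_geometric_of_lt_one hz0 hz1)
    (norm_pow_mul_qPochInf_le hp0 hp1 hz0)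

lemma eulerSeries_mul {p z : ℝ} (hp0 : 0 < p) (hp1 : p < 1) (hz0 : 0 ≤ z) (hz1 : z < 1) :
    eulerSeries p (z * p) = (1 - z) * eulerSeries p z := by
  have hs := summable_eulerSeries hp0 hp1 hz0 hz1
  have hs' := summable_eulerSeries hp0 hp1 (mul_nonneg hz0 hp0.le)
    (by nlinarith : z * p < 1)
  have key : eulerSeries p z - eulerSeries p (z * p) = z * eulerSeries p z := by
    unfold eulerSeries
    rw [← hs.tsum_sub hs', (hs.sub hs').tsum_eq_zero_add, ← tsum_mul_left]
    simp only [pow_zero, sub_self, zero_add]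
    refine tsum_congr fun s => ?_
    rw [qPochInf_eq_mul (p ^ (s + 1)) hp0 hp1, ← pow_succ]
    ring
  linear_combination -key

lemma eulerSeries_mul_pow {p z : ℝ} (hp0 : 0 < p) (hp1 : p < 1) (hz0 : 0 ≤ z) (hz1 : z < 1)
    (n : ℕ) : eulerSeries p (z * p ^ n) = qPoch z p n * eulerSeries p z := by
  induction n with
  | zero => simp [qPoch]
  | succ n ih =>
    have h : z * p ^ n < 1 :=
      (mul_le_of_le_one_right hz0 (pow_le_one₀ hp0.le hp1.le)).trans_lt hz1
    rw [pow_succ, ← mul_assoc, eulerSeries_mul hp0 hp1 (by positivity) h, ih, qPoch, qPoch,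
      Finset.prod_range_succ]
    ring

lemma tendsto_eulerSeries_mul_pow {p z : ℝ} (hp0 : 0 < p) (hp1 : p < 1) (hz0 : 0 ≤ z)
    (hz1 : z < 1) :
    Tendsto (fun n : ℕ => eulerSeries p (z * p ^ n)) atTop (𝓝 (qPochInf p p)) := by
  have hlim : Tendsto (fun n : ℕ => z * p ^ n) atTop (𝓝 0) := by
    simpa using (tendsto_pow_atTop_nhds_zero_of_lt_one hp0.le hp1).const_mul z
  have h0 : qPochInf p p = ∑' s : ℕ, (0 : ℝ) ^ s * qPochInf (p ^ (s + 1)) p := by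
    rw [tsum_eq_single 0 fun s hs => by simp [hs]]
    simp
  rw [h0]
  refine tendsto_tsum_of_dominated_convergence (bound := fun s : ℕ => z ^ s)
    (summable_geometric_of_lt_one hz0 hz1) (fun s => (hlim.pow s).mul_const _)
    (Eventually.of_forall fun n s => ?_)
  refine (norm_pow_mul_qPochInf_le hp0 hp1 (by positivity) s).trans ?_
  exact pow_le_pow_left₀ (by positivity)
    (mul_le_of_le_one_right hz0 (pow_le_one₀ hp0.le hp1.le)) s

lemma qPochInf_mul_eulerSeries {p z : ℝ} (hp0 : 0 < p) (hp1 : p < 1) (hz0 : 0 ≤ z)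
    (hz1 : z < 1) : qPochInf z p * eulerSeries p z = qPochInf p p := by
  refine tendsto_nhds_unique ?_ (tendsto_eulerSeries_mul_pow hp0 hp1 hz0 hz1)
  simp only [eulerSeries_mul_pow hp0 hp1 hz0 hz1]
  exact (tendsto_qPoch z hp0 hp1).mul_const _

/-- Moments of the discrete q-Hermite I weight: the Jackson q-integral
`∫_{-1}^1 x^n (qx;q)_∞ (-qx;q)_∞ d_q x`, i.e. `(1-q) ∑_{s=0}^∞ q^s (f(q^s) + f(-q^s))`,
vanishes for odd `n` and equals `(1-q)(q;q)_∞(-1;q)_∞(-q;q)_∞ (q;q²)_m` for `n = 2m`. -/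
theorem qHermiteI_moments (q : ℝ) (hq0 : 0 < q) (hq1 : q < 1) (n : ℕ) :
    (1 - q) * ∑' s : ℕ, q ^ s *
        ((q ^ s) ^ n * qPochInf (q * q ^ s) q * qPochInf (-(q * q ^ s)) q +
          (-(q ^ s)) ^ n * qPochInf (q * (-(q ^ s))) q * qPochInf (-(q * (-(q ^ s)))) q) =
      if Odd n then 0
      else (1 - q) * qPochInf q q * qPochInf (-1) q * qPochInf (-q) q * qPoch q (q ^ 2) (n / 2) := by
  split_ifs with hn
  · have h : ∀ s : ℕ, q ^ s *
        ((q ^ s) ^ n * qPochInf (q * q ^ s) q * qPochInf (-(q * q ^ s)) q +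
          (-(q ^ s)) ^ n * qPochInf (q * (-(q ^ s))) q * qPochInf (-(q * (-(q ^ s)))) q) = 0 := by
      intro s
      simp only [hn.neg_pow, mul_neg, neg_neg]
      ring
    simp only [h, tsum_zero, mul_zero]
  · obtain ⟨m, rfl⟩ := (Nat.not_odd_iff_even.1 hn).two_dvd
    have h0 : 0 < q ^ 2 := by positivity
    have h1 : q ^ 2 < 1 := by nlinarith
    have h : ∀ s : ℕ, q ^ s *
        ((q ^ s) ^ (2 * m) * qPochInf (q * q ^ s) q * qPochInf (-(q * q ^ s)) q +
          (-(q ^ s)) ^ (2 * m) * qPochInf (q * (-(q ^ s))) q *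
            qPochInf (-(q * (-(q ^ s)))) q) =
        2 * ((q * (q ^ 2) ^ m) ^ s * qPochInf ((q ^ 2) ^ (s + 1)) (q ^ 2)) := by
      intro s
      have hw := qPochInf_mul_qPochInf_neg (q * q ^ s) hq0 hq1
      rw [show (q * q ^ s) ^ 2 = (q ^ 2) ^ (s + 1) by ring] at hw
      rw [(even_two_mul m).neg_pow, mul_neg, neg_neg, ← hw]
      ring
    have hneg := qPochInf_eq_mul (-1) hq0 hq1
    rw [neg_one_mul] at hneg
    have hsum := qPochInf_mul_eulerSeries h0 h1 hq0.le hq1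
    have hE := qPochInf_sq_mul_qPochInf_neg hq0 hq1
    have hprod := qPochInf_mul_qPochInf_neg q hq0 hq1
    have hS : eulerSeries (q ^ 2) q = qPochInf q q * qPochInf (-q) q * qPochInf (-q) q := by
      linear_combination -eulerSeries (q ^ 2) q * hE + qPochInf (-q) q * hsum
        - qPochInf (-q) q * hprod
    simp only [h]
    rw [tsum_mul_left, ← eulerSeries, eulerSeries_mul_pow h0 h1 hq0.le hq1, hS, hneg,
      Nat.mul_div_cancel_left m two_pos]
    ring
end

section
/- Let a be a real number with a > -1. For all polynomial functions φ, ψ : ℝ → ℝ, ∫_0^∞ φ(x) ( x ψ'(x) + ((1 + a - x)/2) ψ(x) ) x^a e^{-x} dx = (1/2) ∫_0^∞ ( φ(x) ψ'(x) - φ'(x) ψ(x) ) x^{a+1} e^{-x} dx. (This identifies the operator A = x d/dx + (1+a-x)/2 as mapping the Laguerre inner product with weight x^a e^{-x} to the skew-symmetric inner product with weight x^{a+1} e^{-x}.) -/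
open MeasureTheory Set Filter Topology Polynomial in
/-- Polynomials are integrable against the Laguerre weight `x^a e^{-x}` on `(0, ∞)`. -/
theorem Polynomial.integrableOn_eval_mul_rpow_mul_exp_neg {a : ℝ} (ha : -1 < a) (q : ℝ[X]) :
    IntegrableOn (fun x : ℝ => q.eval x * (x ^ a * Real.exp (-x))) (Ioi 0) := by
  induction q using Polynomial.induction_on' with
  | add p q hp hq =>
    simp only [eval_add, add_mul]
    exact hp.add hq
  | monomial n c =>
    have hn : -1 < a + n := by linarith [n.cast_nonneg (α := ℝ)]
    have h : IntegrableOn (fun x : ℝ => c * (x ^ (a + n) * Real.exp (-x ^ (1 : ℝ)))) (Ioi 0) :=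
      (integrableOn_rpow_mul_exp_neg_rpow hn one_pos).const_mul c
    refine h.congr_fun (fun x hx => ?_) measurableSet_Ioi
    simp only [eval_monomial, Real.rpow_one, Real.rpow_add hx, Real.rpow_natCast]
    ring

open Filter Topology Polynomial in
/-- The exponential decay of the Laguerre weight dominates every polynomial. -/
theorem Polynomial.tendsto_eval_mul_rpow_mul_exp_neg_atTop (s : ℝ) (q : ℝ[X]) :
    Tendsto (fun x : ℝ => q.eval x * (x ^ s * Real.exp (-x))) atTop (𝓝 0) := by
  induction q using Polynomial.induction_on' with
  | add p q hp hq => simpa only [eval_add, add_mul, add_zero] using hp.add hq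
  | monomial n c =>
    have h := (tendsto_rpow_mul_exp_neg_mul_atTop_nhds_zero (s + n) 1 one_pos).const_mul c
    rw [mul_zero] at h
    refine h.congr' ?_
    filter_upwards [eventually_gt_atTop 0] with x hx
    simp only [eval_monomial, Real.rpow_add hx, Real.rpow_natCast, neg_one_mul]
    ring

open MeasureTheory Set Polynomial in
/-- The derivative of `q(x) x^{a+1} e^{-x}` integrates to zero over `(0, ∞)`. -/
theorem Polynomial.integral_laguerre_derivative_eq_zero {a : ℝ} (ha : -1 < a) (q : ℝ[X]) :
    ∫ x in Ioi (0 : ℝ), (X * derivative q + (C (1 + a) - X) * q).eval x *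
      (x ^ a * Real.exp (-x)) = 0 := by
  have ha' : 0 < a + 1 := by linarith
  have hcont : Continuous fun x : ℝ => q.eval x * (x ^ (a + 1) * Real.exp (-x)) :=
    q.continuous.mul ((Real.continuous_rpow_const ha'.le).mul (by fun_prop))
  have h := integral_Ioi_of_hasDerivAt_of_tendsto hcont.continuousWithinAt
    (f' := fun x => (X * derivative q + (C (1 + a) - X) * q).eval x * (x ^ a * Real.exp (-x)))
    (fun x hx => ?_) (integrableOn_eval_mul_rpow_mul_exp_neg ha _)
    (tendsto_eval_mul_rpow_mul_exp_neg_atTop (a + 1) q)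
  · simpa [Real.zero_rpow ha'.ne'] using h
  · have hx0 : x ≠ 0 := ne_of_gt hx
    have hd := (q.hasDerivAt x).mul
      ((Real.hasDerivAt_rpow_const (p := a + 1) (Or.inl hx0)).mul (hasDerivAt_neg x).exp)
    refine hd.congr_deriv ?_
    simp only [Pi.mul_apply, eval_add, eval_mul, eval_sub, eval_X, eval_C, add_sub_cancel_right,
      Real.rpow_add_one hx0]
    ring


/-- The operator `A = x d/dx + (1+a-x)/2` maps the Laguerre inner product with weight
`x^a e^{-x}` to the skew-symmetric inner product with weight `x^{a+1} e^{-x}`. -/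
theorem laguerre_skew_operator (a : ℝ) (ha : -1 < a) (p r : Polynomial ℝ) :
    ∫ x in Set.Ioi (0 : ℝ),
        p.eval x * (x * r.derivative.eval x + ((1 + a - x) / 2) * r.eval x) *
          (x ^ a * Real.exp (-x)) =
      (1 / 2) * ∫ x in Set.Ioi (0 : ℝ),
        (p.eval x * r.derivative.eval x - p.derivative.eval x * r.eval x) *
          (x ^ (a + 1) * Real.exp (-x)) := by
  open MeasureTheory Polynomial in
  have hl := integrableOn_eval_mul_rpow_mul_exp_neg ha
    (p * derivative r * X - derivative p * r * X)
  have hq := integrableOn_eval_mul_rpow_mul_exp_neg ha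
    (X * derivative (p * r) + (C (1 + a) - X) * (p * r))
  have hz := integral_laguerre_derivative_eq_zero ha (p * r)
  calc
    _ = ∫ x in Set.Ioi (0 : ℝ),
        ((1 / 2) * ((p * derivative r * X - derivative p * r * X).eval x *
            (x ^ a * Real.exp (-x))) +
          (1 / 2) * ((X * derivative (p * r) + (C (1 + a) - X) * (p * r)).eval x *
            (x ^ a * Real.exp (-x)))) := by
      congr 1 with x
      simp only [eval_add, eval_sub, eval_mul, eval_X, eval_C, derivative_mul]
      ring
    _ = (1 / 2) * ∫ x in Set.Ioi (0 : ℝ),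
        (p * derivative r * X - derivative p * r * X).eval x * (x ^ a * Real.exp (-x)) := by
      rw [integral_add (hl.const_mul _) (hq.const_mul _), integral_const_mul, integral_const_mul,
        hz, mul_zero, add_zero]
    _ = _ := by
      congr 1
      refine setIntegral_congr_fun measurableSet_Ioi fun x hx => ?_
      simp only [eval_sub, eval_mul, eval_X, Real.rpow_add_one (ne_of_gt hx)]
      ring
end

section
/- Let a, b be real numbers with a > -1 and b > -1. For all polynomial functions φ, ψ : ℝ → ℝ, ∫_0^1 φ(x) ( x(1-x) ψ'(x) + ((1 + a - (a + b + 2)x)/2) ψ(x) ) x^a (1-x)^b dx = (1/2) ∫_0^1 ( φ(x) ψ'(x) - φ'(x) ψ(x) ) x^{a+1} (1-x)^{b+1} dx. (This identifies the operator A = x(1-x) d/dx + (1+a-(a+b+2)x)/2 as mapping the Jacobi inner product with weight x^a(1-x)^b on [0,1] to the skew-symmetric inner product with weight x^{a+1}(1-x)^{b+1}.) -/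
open MeasureTheory Set

theorem intervalIntegrable_jacobiWeight_left (a b : ℝ) (ha : -1 < a) :
    IntervalIntegrable (fun x : ℝ => x ^ a * (1 - x) ^ b) volume 0 (1 / 2) := by
  refine (intervalIntegral.intervalIntegrable_rpow' ha).mul_continuousOn ?_
  refine ContinuousOn.rpow_const (by fun_prop) fun x hx => Or.inl ?_
  rw [uIcc_of_le (by norm_num)] at hx
  linarith [hx.2]

theorem intervalIntegrable_jacobiWeight (a b : ℝ) (ha : -1 < a) (hb : -1 < b) :
    IntervalIntegrable (fun x : ℝ => x ^ a * (1 - x) ^ b) volume 0 1 := by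
  refine (intervalIntegrable_jacobiWeight_left a b ha).trans ?_
  have h := ((intervalIntegrable_jacobiWeight_left b a hb).comp_sub_left 1).symm
  norm_num at h
  simpa only [mul_comm, one_div] using h

theorem hasDerivAt_mul_jacobiWeight {f : ℝ → ℝ} {f' x : ℝ} (a b : ℝ)
    (hf : HasDerivAt f f' x) (hx : x ∈ Ioo (0 : ℝ) 1) :
    HasDerivAt (fun y => f y * (y ^ (a + 1) * (1 - y) ^ (b + 1)))
      ((x * (1 - x) * f' + (1 + a - (a + b + 2) * x) * f x) * (x ^ a * (1 - x) ^ b)) x := by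
  have h0 : 0 < x := hx.1
  have h1 : 0 < 1 - x := sub_pos.2 hx.2
  have hl := (hasDerivAt_id x).rpow_const (p := a + 1) (Or.inl h0.ne')
  have hr := ((hasDerivAt_id x).const_sub 1).rpow_const (p := b + 1) (Or.inl h1.ne')
  convert! hf.mul (hl.mul hr) using 1
  simp only [id, add_sub_cancel_right, Pi.mul_apply]
  rw [Real.rpow_add_one h0.ne', Real.rpow_add_one h1.ne']
  ring

theorem integral_deriv_mul_jacobiWeight (a b : ℝ) (ha : -1 < a) (hb : -1 < b)
    {f f' : ℝ → ℝ} (hf : ∀ x, HasDerivAt f (f' x) x) (hf' : Continuous f') :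
    ∫ x in (0 : ℝ)..1, (x * (1 - x) * f' x + (1 + a - (a + b + 2) * x) * f x) *
      (x ^ a * (1 - x) ^ b) = 0 := by
  have hc : Continuous f := continuous_iff_continuousAt.2 fun x => (hf x).continuousAt
  rw [intervalIntegral.integral_eq_sub_of_hasDerivAt_of_le zero_le_one ?_
    (fun x hx => hasDerivAt_mul_jacobiWeight a b (hf x) hx)
    ((intervalIntegrable_jacobiWeight a b ha hb).continuousOn_mul (by fun_prop))]
  · simp [Real.zero_rpow (by linarith : a + 1 ≠ 0), Real.zero_rpow (by linarith : b + 1 ≠ 0)]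
  · have hl : Continuous fun x : ℝ => x ^ (a + 1) :=
      Real.continuous_rpow_const (by linarith)
    have hr : Continuous fun x : ℝ => (1 - x) ^ (b + 1) :=
      (Real.continuous_rpow_const (by linarith)).comp (continuous_const.sub continuous_id)
    exact (hc.mul (hl.mul hr)).continuousOn

/-- The operator `A = x(1-x) d/dx + (1+a-(a+b+2)x)/2` maps the Jacobi inner product with
weight `x^a(1-x)^b` on `[0,1]` to the skew-symmetric inner product with weight
`x^{a+1}(1-x)^{b+1}`. -/
theorem jacobi_skew_operator (a b : ℝ) (ha : -1 < a) (hb : -1 < b) (p r : Polynomial ℝ) :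
    ∫ x in Set.Ioo (0 : ℝ) 1,
        p.eval x * (x * (1 - x) * r.derivative.eval x +
          ((1 + a - (a + b + 2) * x) / 2) * r.eval x) * (x ^ a * (1 - x) ^ b) =
      (1 / 2) * ∫ x in Set.Ioo (0 : ℝ) 1,
        (p.eval x * r.derivative.eval x - p.derivative.eval x * r.eval x) *
          (x ^ (a + 1) * (1 - x) ^ (b + 1)) := by
  rw [← integral_Ioc_eq_integral_Ioo, ← integral_Ioc_eq_integral_Ioo,
    ← intervalIntegral.integral_of_le zero_le_one, ← intervalIntegral.integral_of_le zero_le_one]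
  have hW := intervalIntegrable_jacobiWeight a b ha hb
  have hfib := integral_deriv_mul_jacobiWeight a b ha hb
    (f := fun x => p.eval x * r.eval x)
    (fun x => (p.hasDerivAt x).mul (r.hasDerivAt x)) (by fun_prop)
  have hskew : ∫ x in (0 : ℝ)..1, (p.eval x * r.derivative.eval x -
        p.derivative.eval x * r.eval x) * (x ^ (a + 1) * (1 - x) ^ (b + 1)) =
      ∫ x in (0 : ℝ)..1, (p.eval x * r.derivative.eval x -
        p.derivative.eval x * r.eval x) * (x * (1 - x)) * (x ^ a * (1 - x) ^ b) := by
    refine intervalIntegral.integral_congr fun x hx => ?_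
    rw [uIcc_of_le zero_le_one] at hx
    rw [Real.rpow_add_one' hx.1 (by linarith), Real.rpow_add_one' (sub_nonneg.2 hx.2) (by linarith)]
    ring
  have hadd := intervalIntegral.integral_add
    (hW.continuousOn_mul (g := fun x => (p.eval x * r.derivative.eval x -
      p.derivative.eval x * r.eval x) * (x * (1 - x))) (by fun_prop))
    (hW.continuousOn_mul (g := fun x => x * (1 - x) *
      (p.derivative.eval x * r.eval x + p.eval x * r.derivative.eval x) +
      (1 + a - (a + b + 2) * x) * (p.eval x * r.eval x)) (by fun_prop))
  rw [hfib, add_zero] at hadd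
  rw [hskew, ← hadd, ← intervalIntegral.integral_const_mul]
  congr 1 with x
  ring
end
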